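/- (Brouncker-type formula, case n = 1 of Proposition 1) π = 4 - 2/(2 + 1²/(2 + 2²/(2 + 3²/(2 + ···)))); precisely, if L is the limit of the convergents of the generalized continued fraction with partial numerators a_0 = 2 and a_k = k² for k ≥ 1 and all partial denominators equal to 2, then this limit exists and π = 4 - L. -/

import Mathlib

open Filter

/-- `gcfAux a b j m` is the finite continued fraction
`a j / (b j + a (j+1) / (b (j+1) + ⋯ + a (j+m) / b (j+m)))`. -/
noncomputable def gcfAux (a b : ℕ → ℝ) : ℕ → ℕ → ℝ
  | j, 0 => a j / b j
  | j, m + 1 => a j / (b j + gcfAux a b (j + 1) m)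

/-- The `k`-th convergent of the generalized continued fraction
`a₀/(b₀ + a₁/(b₁ + a₂/(b₂ + ⋯)))` (so the `0`-th convergent is `a₀/b₀`). -/
noncomputable def gcfConvergent (a b : ℕ → ℝ) (k : ℕ) : ℝ := gcfAux a b 0 k

noncomputable def brW (k : ℕ) : ℝ :=
  ∫ x in (0:ℝ)..(Real.pi/2), Real.cos x ^ k * ((1 - Real.cos x) / (1 + Real.cos x))

noncomputable def brC (k : ℕ) : ℝ := ∫ x in (0:ℝ)..(Real.pi/2), Real.cos x ^ k

theorem br_cos_nonneg {x : ℝ} (hx : x ∈ Set.Icc (0:ℝ) (Real.pi/2)) : 0 ≤ Real.cos x :=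
  Real.cos_nonneg_of_mem_Icc ⟨by linarith [hx.1, Real.pi_pos], hx.2⟩

theorem br_int (k : ℕ) : IntervalIntegrable
    (fun x => Real.cos x ^ k * ((1 - Real.cos x) / (1 + Real.cos x))) MeasureTheory.volume
    0 (Real.pi/2) := by
  apply ContinuousOn.intervalIntegrable
  rw [Set.uIcc_of_le (by positivity)]
  refine ContinuousOn.mul (by fun_prop) (ContinuousOn.div (by fun_prop) (by fun_prop) ?_)
  intro x hx
  have := br_cos_nonneg hx
  positivity

theorem br_intC (k : ℕ) : IntervalIntegrable
    (fun x => Real.cos x ^ k) MeasureTheory.volume 0 (Real.pi/2) :=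
  Continuous.intervalIntegrable (by fun_prop) _ _

theorem brW_nonneg (k : ℕ) : 0 ≤ brW k := by
  apply intervalIntegral.integral_nonneg (by positivity)
  intro x hx
  have := br_cos_nonneg hx
  have := Real.cos_le_one x
  have : 0 ≤ 1 - Real.cos x := by linarith
  positivity

theorem brW_le (k : ℕ) : brW k ≤ brC k - brC (k+1) := by
  unfold brC
  rw [← intervalIntegral.integral_sub (br_intC k) (br_intC (k+1))]
  apply intervalIntegral.integral_mono_on (by positivity) (br_int k) ((br_intC k).sub (br_intC (k+1)))
  intro x hx
  have h := br_cos_nonneg hx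
  have := Real.cos_le_one x
  have h1 : (1 - Real.cos x) / (1 + Real.cos x) ≤ 1 - Real.cos x :=
    div_le_self (by linarith) (by linarith)
  calc _ ≤ Real.cos x ^ k * (1 - Real.cos x) := by gcongr
    _ = _ := by ring

theorem brW_tendsto : Tendsto brW atTop (nhds 0) := by
  have hanti : Antitone brC := by
    apply antitone_nat_of_succ_le
    intro n
    have := brW_le n
    have := brW_nonneg n
    linarith
  have hb : BddBelow (Set.range brC) := by
    refine ⟨0, ?_⟩
    rintro _ ⟨k, rfl⟩
    apply intervalIntegral.integral_nonneg (by positivity)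
    intro x hx
    have := br_cos_nonneg hx
    positivity
  have h1 := tendsto_atTop_ciInf hanti hb
  have h2 := h1.sub (h1.comp (tendsto_add_atTop_nat 1))
  rw [sub_self] at h2
  exact squeeze_zero brW_nonneg brW_le h2

theorem brW_zero : brW 0 = 2 - Real.pi / 2 := by
  have h := intervalIntegral.integral_eq_sub_of_hasDerivAt
    (f := fun x => 2 * (Real.sin x / (1 + Real.cos x)) - x)
    (f' := fun x => Real.cos x ^ 0 * ((1 - Real.cos x) / (1 + Real.cos x)))
    (a := 0) (b := Real.pi/2) ?_ (br_int 0)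
  · unfold brW
    rw [h]
    simp
  · intro x hx
    rw [Set.uIcc_of_le (by positivity)] at hx
    have hc := br_cos_nonneg hx
    have hne : 1 + Real.cos x ≠ 0 := by positivity
    have := (((Real.hasDerivAt_sin x).div ((Real.hasDerivAt_cos x).const_add 1) hne).const_mul 2).sub
      (hasDerivAt_id x)
    refine this.congr_deriv ?_
    field_simp
    have := Real.sin_sq_add_cos_sq x
    linear_combination 2 * this

theorem brW_one : brW 1 = Real.pi - 3 := by
  have h : brW 0 + brW 1 = brC 0 - brC 1 := by
    unfold brC brW
    rw [← intervalIntegral.integral_sub (br_intC 0) (br_intC 1),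
      ← intervalIntegral.integral_add (br_int 0) (br_int 1)]
    apply intervalIntegral.integral_congr
    intro x hx
    rw [Set.uIcc_of_le (by positivity)] at hx
    have hc := br_cos_nonneg hx
    have hne : 1 + Real.cos x ≠ 0 := by positivity
    simp only
    field_simp
  have h0 : brC 0 = Real.pi/2 := by simp [brC]
  have h1 : brC 1 = 1 := by simp [brC]
  rw [brW_zero, h0, h1] at h
  linarith

theorem brW_rec (k : ℕ) :
    ((k:ℝ)+2) * brW (k+2) = ((k:ℝ)+1) * brW k - 2 * brW (k+1) := by
  have hi := (((br_int (k+2)).const_mul ((k:ℝ)+2)).add ((br_int (k+1)).const_mul 2)).sub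
    ((br_int k).const_mul ((k:ℝ)+1))
  have h := intervalIntegral.integral_eq_sub_of_hasDerivAt
    (f := fun x => Real.cos x ^ (k+1) * (Real.sin x * ((1 - Real.cos x) / (1 + Real.cos x))))
    (a := 0) (b := Real.pi/2) ?_ hi
  · have e := intervalIntegral.integral_sub
      (((br_int (k+2)).const_mul ((k:ℝ)+2)).add ((br_int (k+1)).const_mul 2))
      ((br_int k).const_mul ((k:ℝ)+1))
    have e2 := intervalIntegral.integral_add
      ((br_int (k+2)).const_mul ((k:ℝ)+2)) ((br_int (k+1)).const_mul 2)
    rw [e, e2] at h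
    simp only [intervalIntegral.integral_const_mul] at h
    simp at h
    unfold brW
    linarith
  · intro x hx
    rw [Set.uIcc_of_le (by positivity)] at hx
    have hc := br_cos_nonneg hx
    have hne : 1 + Real.cos x ≠ 0 := by positivity
    have := ((Real.hasDerivAt_cos x).pow (k+1)).mul ((Real.hasDerivAt_sin x).mul
      (((Real.hasDerivAt_cos x).const_sub 1).div ((Real.hasDerivAt_cos x).const_add 1) hne))
    refine this.congr_deriv ?_
    simp
    field_simp
    have hs : Real.sin x ^ 2 = 1 - Real.cos x ^ 2 := Real.sin_sq x
    ring_nf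
    try simp only [hs]
    try ring_nf

noncomputable def brB : ℕ → ℝ
  | 0 => 1
  | 1 => 2
  | k+2 => 2 * brB (k+1) + ((k:ℝ)+1)^2 * brB k

noncomputable def brA : ℕ → ℝ
  | 0 => 0
  | 1 => 2
  | k+2 => 2 * brA (k+1) + ((k:ℝ)+1)^2 * brA k

theorem brB_ge (k : ℕ) : (k.factorial : ℝ) ≤ brB k ∧ ((k+1).factorial : ℝ) ≤ brB (k+1) := by
  induction k with
  | zero => simp [brB]
  | succ k ih =>
    refine ⟨ih.2, ?_⟩
    have h1 : 2 * ((k+1).factorial : ℝ) + ((k:ℝ)+1)^2 * (k.factorial : ℝ) ≤ brB (k+2) := by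
      rw [brB]
      gcongr
      exacts [ih.2, ih.1]
    refine le_trans ?_ h1
    have : (0:ℝ) ≤ k.factorial := by positivity
    simp only [Nat.factorial_succ]
    push_cast
    nlinarith [mul_nonneg (Nat.cast_nonneg (α := ℝ) k) this]

theorem brB_pos (k : ℕ) : 0 < brB k :=
  lt_of_lt_of_le (by positivity) (brB_ge k).1

theorem brE (k : ℕ) :
    brA k - 2 * brW 0 * brB k = - 2 * (-1)^k * k.factorial * brW k ∧
    brA (k+1) - 2 * brW 0 * brB (k+1) = - 2 * (-1)^(k+1) * (k+1).factorial * brW (k+1) := by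
  induction k with
  | zero => 
    simp [brA, brB, brW_zero, brW_one]
    ring
  | succ k ih =>
    refine ⟨ih.2, ?_⟩
    have := brW_rec k
    obtain ⟨h1, h2⟩ := ih
    rw [show k + 1 + 1 = k + 2 from rfl, brA, brB]
    simp only [Nat.factorial_succ] at *
    push_cast at *
    linear_combination 2 * h2 + ((k:ℝ)+1)^2 * h1 +
      2 * (-1)^k * ((k:ℝ)+1) * k.factorial * this

noncomputable abbrev bra : ℕ → ℝ := fun j => if j = 0 then (2 : ℝ) else (j : ℝ) ^ 2

theorem br_aux_nonneg (m : ℕ) : ∀ j, 0 ≤ gcfAux bra (fun _ => (2:ℝ)) j m := by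
  have ha : ∀ j, 0 ≤ bra j := by
    intro j
    simp only [bra]
    split_ifs <;> positivity
  induction m with
  | zero => intro j; rw [gcfAux]; have := ha j; positivity
  | succ m ih => intro j; rw [gcfAux]; have := ha j; have := ih (j+1); positivity

theorem br_conv (m : ℕ) : ∀ j,
    (brA (j+1) + gcfAux bra (fun _ => (2:ℝ)) (j+1) m * brA j) /
    (brB (j+1) + gcfAux bra (fun _ => (2:ℝ)) (j+1) m * brB j) = brA (j+m+2) / brB (j+m+2) := by
  have ha : ∀ j : ℕ, bra (j+1) = ((j:ℝ)+1)^2 := by intro j; simp [bra]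
  induction m with
  | zero =>
    intro j
    rw [gcfAux, ha, add_zero, brA, brB]
    have := brB_pos j
    have := brB_pos (j+1)
    rw [div_eq_div_iff (by positivity) (by positivity)]
    ring
  | succ m ih =>
    intro j
    have h := ih (j+1)
    rw [show j + (m+1) + 2 = j + 1 + m + 2 by ring, ← h, gcfAux, ha]
    have hy := br_aux_nonneg m (j+1+1)
    set y := gcfAux bra (fun _ => (2:ℝ)) (j+1+1) m
    rw [show j + 1 + 1 = j + 2 from rfl, brA, brB]
    have := brB_pos j
    have := brB_pos (j+1)
    rw [div_eq_div_iff (by positivity) (by positivity)]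
    field_simp
    ring

theorem br_conv' (m : ℕ) :
    gcfConvergent bra (fun _ => (2:ℝ)) m = brA (m+1) / brB (m+1) := by
  cases m with
  | zero => simp [gcfConvergent, gcfAux, brA, brB, bra]
  | succ m =>
    have h := br_conv m 0
    rw [gcfConvergent, gcfAux, show m + 1 + 1 = 0 + m + 2 by ring, ← h]
    simp [brA, brB, bra]

/-- Brouncker-type formula (Proposition 1 with `n = 1`):
`π = 4 - 2/(2 + 1²/(2 + 2²/(2 + 3²/(2 + ⋯))))`, i.e. the convergents of the
generalized continued fraction with numerators `2, 1², 2², 3², …` and all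
denominators equal to `2` converge to a limit `L` with `π = 4 - L`. -/
theorem brouncker_type_formula :
    ∃ L : ℝ,
      Tendsto
        (fun k => gcfConvergent
          (fun j => if j = 0 then (2 : ℝ) else (j : ℝ) ^ 2) (fun _ => (2 : ℝ)) k)
        atTop (nhds L) ∧
      Real.pi = 4 - L := by
  refine ⟨2 * brW 0, ?_, by rw [brW_zero]; ring⟩
  change Tendsto (fun k => gcfConvergent bra (fun _ => (2:ℝ)) k) atTop (nhds (2 * brW 0))
  have hw : Tendsto (fun k => 2 * brW (k+1)) atTop (nhds 0) := by
    simpa using (brW_tendsto.comp (tendsto_add_atTop_nat 1)).const_mul 2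
  rw [tendsto_iff_dist_tendsto_zero]
  refine squeeze_zero (fun _ => dist_nonneg) (fun k => ?_) hw
  have hB := brB_pos (k+1)
  have h1 := (brE k).2
  have h2 := (brB_ge (k+1)).1
  have hW := brW_nonneg (k+1)
  rw [br_conv', Real.dist_eq]
  have e : brA (k+1) / brB (k+1) - 2 * brW 0 = (brA (k+1) - 2 * brW 0 * brB (k+1)) / brB (k+1) := by
    field_simp
  rw [e, abs_div, abs_of_pos hB, div_le_iff₀ hB, h1]
  simp only [abs_mul, abs_neg, abs_pow, abs_one, one_pow, abs_two, Nat.abs_cast, abs_of_nonneg hW]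
  nlinarith [mul_le_mul_of_nonneg_left h2 hW]
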